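/- For β ∈ (0,2), the quantity Ψ_β := sup_{x ∈ ℝ} G_β(1,x)² / 𝒢_β(1,x) is finite, and for β ∈ (0,1), the quantity Ψ̲_β := inf_{x ∈ ℝ} G_β(1,x)² / 𝒢̲_β(1,x) is strictly positive, where 𝒢̲_β(1,x) = (4π)^{−1/2} · exp(−x²/4). -/

import Mathlib

open MeasureTheory

/-- The two-parameter Mainardi function `M_{λ,μ}(z) = ∑ (−z)^n / (n! Γ(μ − (n+1)λ))`,
with the convention that `1/Γ` vanishes at the nonpositive integers. -/
noncomputable def mainardiR (lam mu z : ℝ) : ℝ :=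
  ∑' n : ℕ, (-z) ^ n / ((n.factorial : ℝ) * Real.Gamma (mu - ((n : ℝ) + 1) * lam))

/-- The Green function `G_β(t,x) = (t^{⌈β⌉−1−β/2}/2) M_{β/2,⌈β⌉}(|x|/t^{β/2})` of the
time-fractional diffusion equation. -/
noncomputable def greenG (β t x : ℝ) : ℝ :=
  t ^ ((⌈β⌉₊ : ℝ) - 1 - β / 2) / 2 * mainardiR (β / 2) (⌈β⌉₊ : ℝ) (|x| / t ^ (β / 2))

/-- The reference kernel `𝒢_β`: the exponential kernel for `0 < β < 1` and the Gaussian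
kernel `(4π t^β)^{−1/2} exp(−x²/(4t^β))` for `1 ≤ β < 2`. -/
noncomputable def refKernel (β t x : ℝ) : ℝ :=
  if β < 1 then 1 / (2 * t ^ (β / 2)) * Real.exp (-|x| / t ^ (β / 2))
  else (4 * Real.pi * t ^ β) ^ (-(1 : ℝ) / 2) * Real.exp (-x ^ 2 / (4 * t ^ β))

open Filter Topology Set

lemma pow_absorb {p q ε : ℝ} (A : ℝ) (hp : 0 ≤ p) (hpq : p < q) (hε : 0 < ε) :
    ∃ K : ℝ, ∀ t : ℝ, 0 ≤ t → A * t ^ p ≤ ε * t ^ q + K := by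
  refine ⟨|A| * ((|A| / ε) ^ (1 / (q - p))) ^ p, fun t ht => ?_⟩
  have hA : A * t ^ p ≤ |A| * t ^ p :=
    mul_le_mul_of_nonneg_right (le_abs_self A) (Real.rpow_nonneg ht _)
  have hqp : 0 < q - p := by linarith
  have hT : 0 ≤ |A| / ε := by positivity
  refine hA.trans ?_
  rcases le_total t ((|A| / ε) ^ (1 / (q - p))) with h | h
  · have h1 : t ^ p ≤ ((|A| / ε) ^ (1 / (q - p))) ^ p := Real.rpow_le_rpow ht h hp
    have h2 : 0 ≤ ε * t ^ q := by positivity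
    have h3 := mul_le_mul_of_nonneg_left h1 (abs_nonneg A)
    linarith
  · have h1 : |A| / ε ≤ t ^ (q - p) := by
      have := Real.rpow_le_rpow (by positivity) h hqp.le
      rwa [← Real.rpow_mul hT, one_div, inv_mul_cancel₀ hqp.ne', Real.rpow_one] at this
    have h2 : |A| ≤ ε * t ^ (q - p) := by
      rw [div_le_iff₀ hε] at h1; linarith
    have h3 : t ^ q = t ^ (q - p) * t ^ p := by
      rcases ht.eq_or_lt with rfl | ht
      · rcases hp.eq_or_lt with rfl | hp
        · simp
        · rw [Real.zero_rpow hp.ne', Real.zero_rpow (by linarith)]; simp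
      · rw [← Real.rpow_add ht]; congr 1; ring
    have h4 : |A| * t ^ p ≤ ε * t ^ (q - p) * t ^ p :=
      mul_le_mul_of_nonneg_right h2 (Real.rpow_nonneg ht _)
    have h5 : 0 ≤ |A| * ((|A| / ε) ^ (1 / (q - p))) ^ p := by positivity
    rw [h3]; linarith

noncomputable def gW (s lam z : ℝ) (w : ℂ) : ℂ :=
  Complex.exp (s * w + Complex.exp w - z * Complex.exp (lam * w))

lemma exp_mul_logI (a : ℝ) {t : ℝ} (ht : 0 < t) (ψ : ℝ) :
    Complex.exp (a * ((Real.log t : ℂ) + ψ * Complex.I)) =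
      ((t ^ a * Real.cos (a * ψ) : ℝ) : ℂ) + ((t ^ a * Real.sin (a * ψ) : ℝ) : ℂ) * Complex.I := by
  have h : (a : ℂ) * ((Real.log t : ℂ) + ψ * Complex.I) =
      ((Real.log t * a : ℝ) : ℂ) + ((a * ψ : ℝ) : ℂ) * Complex.I := by
    push_cast; ring
  rw [h, Complex.exp_add, Complex.exp_mul_I, ← Complex.ofReal_exp, ← Complex.ofReal_cos,
    ← Complex.ofReal_sin, ← Real.rpow_def_of_pos ht]
  push_cast; ring

lemma exp_logI {t : ℝ} (ht : 0 < t) (ψ : ℝ) :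
    Complex.exp ((Real.log t : ℂ) + ψ * Complex.I) =
      ((t * Real.cos ψ : ℝ) : ℂ) + ((t * Real.sin ψ : ℝ) : ℂ) * Complex.I := by
  have := exp_mul_logI 1 ht ψ
  simpa using this

/-- Value of `gW` in polar form. -/
lemma gW_logI (s lam z : ℝ) {t : ℝ} (ht : 0 < t) (ψ : ℝ) :
    gW s lam z ((Real.log t : ℂ) + ψ * Complex.I) =
      ((t ^ s * Real.exp (t * Real.cos ψ - z * (t ^ lam * Real.cos (lam * ψ))) : ℝ) : ℂ) *
      Complex.exp (((s * ψ + t * Real.sin ψ - z * (t ^ lam * Real.sin (lam * ψ)) : ℝ) : ℂ)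
        * Complex.I) := by
  unfold gW
  rw [exp_logI ht, exp_mul_logI lam ht, Real.rpow_def_of_pos ht s, ← Real.exp_add,
    Complex.ofReal_exp, ← Complex.exp_add]
  congr 1
  push_cast; ring

lemma norm_gW_logI (s lam z : ℝ) {t : ℝ} (ht : 0 < t) (ψ : ℝ) :
    ‖gW s lam z ((Real.log t : ℂ) + ψ * Complex.I)‖ =
      t ^ s * Real.exp (t * Real.cos ψ - z * (t ^ lam * Real.cos (lam * ψ))) := by
  rw [gW_logI s lam z ht, norm_mul, Complex.norm_exp_ofReal_mul_I, mul_one, Complex.norm_real,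
    Real.norm_of_nonneg (by positivity)]

lemma gW_differentiable (s lam z : ℝ) : Differentiable ℂ (gW s lam z) := by
  unfold gW; fun_prop

/-- A primitive of `gW` which is real on the real line. -/
lemma exists_prim (s lam z : ℝ) : ∃ H : ℂ → ℂ, (∀ w, HasDerivAt H (gW s lam z w) w) ∧
    ∀ x : ℝ, (H x).im = 0 := by
  obtain ⟨G, hG⟩ := (gW_differentiable s lam z).isExactOn_univ
  have hG' : ∀ w, HasDerivAt G (gW s lam z w) w := fun w => hG w (mem_univ _)
  refine ⟨fun w => G w - G 0, fun w => (hG' w).sub_const _, ?_⟩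
  have hd : ∀ x : ℝ, HasDerivAt (fun x : ℝ => (G x).im) 0 x := by
    intro x
    have h1 : HasDerivAt (fun x : ℝ => G x) (gW s lam z x) x := (hG' x).comp_ofReal
    have h2 := (Complex.imCLM.hasFDerivAt (x := G x)).comp_hasDerivAt x h1
    have h3 : (gW s lam z x).im = 0 := by
      have : gW s lam z x = ((Real.exp (s * x + Real.exp x - z * Real.exp (lam * x)) : ℝ) : ℂ) := by
        unfold gW; push_cast; rfl
      rw [this, Complex.ofReal_im]
    simpa [h3, Function.comp_def] using h2
  intro x
  have := is_const_of_deriv_eq_zero (f := fun x : ℝ => (G x).im)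
    (fun x => (hd x).differentiableAt) (fun x => (hd x).deriv) x 0
  simp at this
  simp [this]

lemma integrable_dom {s lam k : ℝ} (A : ℝ) (hs : 0 < s) (hl : 0 ≤ lam) (hl1 : lam < 1)
    (hk : 0 < k) :
    IntegrableOn (fun t : ℝ => t ^ (s - 1) * Real.exp (-k * t + A * t ^ lam)) (Ioi 0) := by
  obtain ⟨K, hK⟩ := pow_absorb A hl hl1 (half_pos hk)
  have h1 := (integrableOn_rpow_mul_exp_neg_mul_rpow (p := 1) (s := s - 1) (b := k / 2)
    (by linarith) one_pos (half_pos hk)).const_mul (Real.exp K)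
  refine Integrable.mono' h1 ?_ ?_
  · apply ContinuousOn.aestronglyMeasurable _ measurableSet_Ioi
    intro t ht
    have ht : (0 : ℝ) < t := ht
    apply ContinuousAt.continuousWithinAt
    have : t ≠ 0 := ht.ne'
    fun_prop (disch := simp [this])
  · refine (ae_restrict_iff' measurableSet_Ioi).2 (Eventually.of_forall fun t ht => ?_)
    have ht : (0 : ℝ) < t := ht
    rw [Real.norm_of_nonneg (by positivity)]
    have h2 := hK t ht.le
    rw [mul_left_comm, ← Real.exp_add]
    refine mul_le_mul_of_nonneg_left (Real.exp_le_exp.2 ?_) (by positivity)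
    simp only [Real.rpow_one] at h2 ⊢
    linarith

lemma tendsto_dom {lam k : ℝ} (s A : ℝ) (hl : 0 ≤ lam) (hl1 : lam < 1)
    (hk : 0 < k) :
    Tendsto (fun t : ℝ => t ^ s * Real.exp (-k * t + A * t ^ lam)) atTop (𝓝 0) := by
  obtain ⟨K, hK⟩ := pow_absorb A hl hl1 (half_pos hk)
  have h1 := (tendsto_rpow_mul_exp_neg_mul_atTop_nhds_zero s (k / 2) (half_pos hk)).const_mul
    (Real.exp K)
  rw [mul_zero] at h1
  refine tendsto_of_tendsto_of_tendsto_of_le_of_le' tendsto_const_nhds h1 ?_ ?_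
  · filter_upwards [eventually_gt_atTop 0] with t ht
    positivity
  · filter_upwards [eventually_gt_atTop 0] with t ht
    have h2 := hK t ht.le
    rw [mul_left_comm, ← Real.exp_add]
    refine mul_le_mul_of_nonneg_left (Real.exp_le_exp.2 ?_) (by positivity)
    simp only [Real.rpow_one] at h2
    linarith

lemma hasSum_exp_complex (x : ℂ) : HasSum (fun n : ℕ => x ^ n / (n.factorial : ℂ)) (Complex.exp x) := by
  rw [Complex.exp_eq_exp_ℂ]; exact NormedSpace.expSeries_div_hasSum_exp x

lemma hasSum_exp_real (x : ℝ) : HasSum (fun n : ℕ => x ^ n / (n.factorial : ℝ)) (Real.exp x) := by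
  rw [Real.exp_eq_exp_ℝ]; exact NormedSpace.expSeries_div_hasSum_exp x

noncomputable def fI (s lam z t : ℝ) : ℝ :=
  (gW s lam z ((Real.log t : ℂ) + (Real.pi : ℝ) * Complex.I)).im / t

lemma hasSum_fI (s lam z : ℝ) {t : ℝ} (ht : 0 < t) :
    HasSum (fun n : ℕ => (-z) ^ n / (n.factorial : ℝ) *
      (t ^ (s + n * lam - 1) * Real.exp (-t) * Real.sin (Real.pi * (s + n * lam)))) (fI s lam z t) := by
  set w : ℂ := (Real.log t : ℂ) + (Real.pi : ℝ) * Complex.I with hw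
  have hexp : Complex.exp w = ((-t : ℝ) : ℂ) := by
    rw [hw, exp_logI ht]; simp
  have h1 := (hasSum_exp_complex (-z * Complex.exp (lam * w))).mul_left
    (Complex.exp (s * w) * Complex.exp (((-t : ℝ) : ℂ)))
  have h2 : Complex.exp (s * w) * Complex.exp (((-t : ℝ) : ℂ)) *
      Complex.exp (-z * Complex.exp (lam * w)) = gW s lam z w := by
    unfold gW
    rw [hexp, ← Complex.exp_add, ← Complex.exp_add]; congr 1; ring
  rw [h2] at h1
  have h3 := (Complex.hasSum_im h1).div_const t
  refine (h3.congr_fun ?_)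
  intro n
  have h4 : Complex.exp (s * w) * Complex.exp (((-t : ℝ) : ℂ)) *
      ((-z * Complex.exp (lam * w)) ^ n / (n.factorial : ℂ)) =
      (((-z) ^ n / (n.factorial : ℝ) * Real.exp (-t) : ℝ) : ℂ) *
        Complex.exp (((s + n * lam : ℝ) : ℂ) * w) := by
    have : Complex.exp (((s + n * lam : ℝ) : ℂ) * w) =
        Complex.exp (s * w) * Complex.exp (lam * w) ^ n := by
      rw [← Complex.exp_nat_mul, ← Complex.exp_add]; congr 1; push_cast; ring
    rw [this, mul_pow]; push_cast; ring
  rw [h4, Complex.im_ofReal_mul, hw, exp_mul_logI _ ht, Real.rpow_sub_one ht.ne', Complex.add_im,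
    Complex.ofReal_im, Complex.im_ofReal_mul, Complex.I_im, mul_comm Real.pi]
  ring

lemma abs_fI_le (s lam z : ℝ) {t : ℝ} (ht : 0 < t) :
    |fI s lam z t| ≤ t ^ (s - 1) * Real.exp (-1 * t + |z| * t ^ lam) := by
  unfold fI
  rw [abs_div, abs_of_pos ht, Real.rpow_sub_one ht.ne', div_mul_eq_mul_div]
  apply div_le_div_of_nonneg_right _ ht.le
  refine (Complex.abs_im_le_norm _).trans ?_
  rw [norm_gW_logI _ _ _ ht]
  refine mul_le_mul_of_nonneg_left (Real.exp_le_exp.2 ?_) (by positivity)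
  rw [Real.cos_pi]
  have h1 : |z * (t ^ lam * Real.cos (lam * Real.pi))| ≤ |z| * t ^ lam := by
    rw [abs_mul, abs_mul, abs_of_nonneg (Real.rpow_nonneg ht.le lam)]
    have := Real.abs_cos_le_one (lam * Real.pi)
    have h2 : 0 ≤ t ^ lam := Real.rpow_nonneg ht.le lam
    have h3 : t ^ lam * |Real.cos (lam * Real.pi)| ≤ t ^ lam := by nlinarith
    exact mul_le_mul_of_nonneg_left h3 (abs_nonneg z)
  have := neg_le_of_abs_le h1
  linarith

lemma continuousOn_fI (s lam z : ℝ) : ContinuousOn (fI s lam z) (Ioi 0) := by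
  intro t ht
  have ht : t ≠ 0 := (show (0:ℝ) < t from ht).ne'
  apply ContinuousAt.continuousWithinAt
  unfold fI
  refine ContinuousAt.div ?_ continuousAt_id ht
  refine Complex.continuous_im.continuousAt.comp ?_
  refine ContinuousAt.comp (g := gW s lam z) (gW_differentiable s lam z).continuous.continuousAt ?_
  have := Real.continuousAt_log ht
  have := Complex.continuous_ofReal.continuousAt.comp this
  exact this.add continuousAt_const

lemma integrable_fI {s lam : ℝ} (z : ℝ) (hs : 0 < s) (hl : 0 ≤ lam) (hl1 : lam < 1) :
    IntegrableOn (fI s lam z) (Ioi 0) := by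
  refine Integrable.mono' (integrable_dom |z| hs hl hl1 one_pos)
    ((continuousOn_fI s lam z).aestronglyMeasurable measurableSet_Ioi) ?_
  exact (ae_restrict_iff' measurableSet_Ioi).2 (Eventually.of_forall fun t ht => abs_fI_le s lam z ht)

lemma Gamma_sin (x : ℝ) (hx : 0 < x) :
    Real.Gamma x * Real.sin (Real.pi * x) = Real.pi / Real.Gamma (1 - x) := by
  have h := Real.Gamma_mul_Gamma_one_sub x
  have hx' := (Real.Gamma_pos_of_pos hx).ne'
  by_cases h0 : Real.sin (Real.pi * x) = 0
  · rw [h0, div_zero] at h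
    rcases mul_eq_zero.1 h with h | h
    · exact absurd h hx'
    · rw [h0, h]; simp
  · have h1 : Real.Gamma (1 - x) ≠ 0 := by
      intro h1
      rw [h1, mul_zero] at h
      exact div_ne_zero Real.pi_ne_zero h0 h.symm
    rw [eq_div_iff h0] at h
    rw [eq_div_iff h1]; linarith

/-- The series of Mainardi type as a real integral. -/
lemma series_hasSum {s lam : ℝ} (z : ℝ) (hs : 0 < s) (hl : 0 ≤ lam) (hl1 : lam < 1) :
    HasSum (fun n : ℕ => (-z) ^ n / ((n.factorial : ℝ) * Real.Gamma (1 - s - n * lam)))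
      ((∫ t in Ioi 0, fI s lam z t) / Real.pi) := by
  have key : HasSum (fun n : ℕ => ∫ t in Ioi (0:ℝ), (-z) ^ n / (n.factorial : ℝ) *
      (t ^ (s + n * lam - 1) * Real.exp (-t) * Real.sin (Real.pi * (s + n * lam))))
      (∫ t in Ioi 0, fI s lam z t) := by
    have hb : ∀ t : ℝ, 0 < t → HasSum (fun n : ℕ => t ^ (s - 1) * Real.exp (-t) *
        ((|z| * t ^ lam) ^ n / (n.factorial : ℝ)))
        (t ^ (s - 1) * Real.exp (-1 * t + |z| * t ^ lam)) := by
      intro t ht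
      have := (hasSum_exp_real (|z| * t ^ lam)).mul_left (t ^ (s - 1) * Real.exp (-t))
      rw [mul_assoc, ← Real.exp_add] at this
      simpa using this
    refine hasSum_integral_of_dominated_convergence
      (fun n t => t ^ (s - 1) * Real.exp (-t) * ((|z| * t ^ lam) ^ n / (n.factorial : ℝ)))
      ?_ ?_ ?_ ?_ ?_
    · intro n
      apply ContinuousOn.aestronglyMeasurable _ measurableSet_Ioi
      intro t ht
      have ht : (0 : ℝ) < t := ht
      apply ContinuousAt.continuousWithinAt
      have : t ≠ 0 := ht.ne'
      fun_prop (disch := simp [this])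
    · intro n
      refine (ae_restrict_iff' measurableSet_Ioi).2 (Eventually.of_forall fun t ht => ?_)
      have ht : (0 : ℝ) < t := ht
      have h1 : t ^ (s + n * lam - 1) = t ^ (s - 1) * (t ^ lam) ^ n := by
        rw [← Real.rpow_natCast, ← Real.rpow_mul ht.le, ← Real.rpow_add ht]; congr 1; ring
      rw [h1, Real.norm_eq_abs, abs_mul, abs_mul, abs_div, abs_pow, abs_neg, mul_pow,
        abs_of_nonneg (show (0:ℝ) ≤ n.factorial by positivity),
        abs_of_nonneg (show 0 ≤ t ^ (s - 1) * (t ^ lam) ^ n * Real.exp (-t) by positivity)]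
      have h2 := Real.abs_sin_le_one (Real.pi * (s + n * lam))
      calc |z| ^ n / (n.factorial : ℝ) * (t ^ (s - 1) * (t ^ lam) ^ n * Real.exp (-t) *
            |Real.sin (Real.pi * (s + n * lam))|)
          ≤ |z| ^ n / (n.factorial : ℝ) * (t ^ (s - 1) * (t ^ lam) ^ n * Real.exp (-t) * 1) := by
            gcongr
        _ = _ := by ring
    · refine (ae_restrict_iff' measurableSet_Ioi).2 (Eventually.of_forall fun t ht => ?_)
      exact (hb t ht).summable
    · refine (integrable_dom |z| hs hl hl1 one_pos).congr ?_
      refine (ae_restrict_iff' measurableSet_Ioi).2 (Eventually.of_forall fun t ht => ?_)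
      exact (hb t ht).tsum_eq.symm
    · exact (ae_restrict_iff' measurableSet_Ioi).2
        (Eventually.of_forall fun t ht => hasSum_fI s lam z ht)
  refine (key.div_const Real.pi).congr_fun ?_
  intro n
  have hsn : 0 < s + n * lam := by positivity
  have h1 : ∀ t : ℝ, (-z) ^ n / (n.factorial : ℝ) *
      (t ^ (s + n * lam - 1) * Real.exp (-t) * Real.sin (Real.pi * (s + n * lam))) =
      (-z) ^ n / (n.factorial : ℝ) * Real.sin (Real.pi * (s + n * lam)) *
      (Real.exp (-t) * t ^ (s + n * lam - 1)) := fun t => by ring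
  simp only [h1]
  rw [integral_const_mul, ← Real.Gamma_eq_integral hsn]
  have h2 := Gamma_sin _ hsn
  rw [mul_assoc, mul_comm (Real.sin _), h2, show 1 - (s + n * lam) = 1 - s - n * lam by ring]
  have := Real.pi_ne_zero
  field_simp

lemma norm_gW_le (s lam z : ℝ) {t : ℝ} (ht : 0 < t) (ψ k : ℝ) (hk : Real.cos ψ ≤ k) :
    ‖gW s lam z ((Real.log t : ℂ) + ψ * Complex.I)‖ ≤ t ^ s * Real.exp (k * t + |z| * t ^ lam) := by
  rw [norm_gW_logI _ _ _ ht]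
  refine mul_le_mul_of_nonneg_left (Real.exp_le_exp.2 ?_) (by positivity)
  have h1 : |z * (t ^ lam * Real.cos (lam * ψ))| ≤ |z| * t ^ lam := by
    rw [abs_mul, abs_mul, abs_of_nonneg (Real.rpow_nonneg ht.le lam)]
    have := Real.abs_cos_le_one (lam * ψ)
    have h2 : 0 ≤ t ^ lam := Real.rpow_nonneg ht.le lam
    have h3 : t ^ lam * |Real.cos (lam * ψ)| ≤ t ^ lam := by nlinarith
    exact mul_le_mul_of_nonneg_left h3 (abs_nonneg z)
  have := neg_le_of_abs_le h1
  nlinarith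

lemma vert_bound {s lam z : ℝ} {H : ℂ → ℂ} (hH : ∀ w, HasDerivAt H (gW s lam z w) w)
    (x : ℂ) {a b B : ℝ} (hab : a ≤ b)
    (hB : ∀ ψ ∈ Icc a b, ‖gW s lam z (x + (ψ : ℂ) * Complex.I)‖ ≤ B) :
    ‖H (x + (b : ℂ) * Complex.I) - H (x + (a : ℂ) * Complex.I)‖ ≤ B * (b - a) := by
  have hd : ∀ ψ : ℝ, HasDerivAt (fun ψ : ℝ => H (x + (ψ : ℂ) * Complex.I))
      (gW s lam z (x + (ψ : ℂ) * Complex.I) * Complex.I) ψ := by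
    intro ψ
    have h1 : HasDerivAt (fun ψ : ℝ => x + (ψ : ℂ) * Complex.I) Complex.I ψ := by
      have := ((hasDerivAt_id ψ).ofReal_comp.mul_const Complex.I).const_add x
      simpa using this
    exact (hH _).comp ψ h1
  refine norm_image_sub_le_of_norm_deriv_le_segment' (f := fun ψ : ℝ => H (x + (ψ : ℂ) * Complex.I))
    (fun ψ _ => (hd ψ).hasDerivWithinAt) (fun ψ hψ => ?_) b (right_mem_Icc.2 hab)
  rw [norm_mul, Complex.norm_I, mul_one]
  exact hB ψ (Ico_subset_Icc_self hψ)

lemma hasDerivAt_ray {s lam z : ℝ} {H : ℂ → ℂ} (hH : ∀ w, HasDerivAt H (gW s lam z w) w)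
    (ψ : ℝ) {t : ℝ} (ht : 0 < t) :
    HasDerivAt (fun t : ℝ => H ((Real.log t : ℂ) + ψ * Complex.I))
      (gW s lam z ((Real.log t : ℂ) + ψ * Complex.I) / t) t := by
  have h1 : HasDerivAt (fun t : ℝ => (Real.log t : ℂ) + ψ * Complex.I) ((t⁻¹ : ℝ) : ℂ) t :=
    ((Real.hasDerivAt_log ht.ne').ofReal_comp).add_const _
  have := (hH ((Real.log t : ℂ) + ψ * Complex.I)).comp t h1
  rw [div_eq_mul_inv, ← Complex.ofReal_inv]
  exact this

lemma HasDerivAt.im' {f : ℝ → ℂ} {f' : ℂ} {x : ℝ} (h : HasDerivAt f f' x) :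
    HasDerivAt (fun x => (f x).im) f'.im x :=
  (Complex.imCLM.hasFDerivAt (x := f x)).comp_hasDerivAt x h

lemma lim_pi {s lam z : ℝ} {H : ℂ → ℂ} (hH : ∀ w, HasDerivAt H (gW s lam z w) w)
    (hR : ∀ x : ℝ, (H x).im = 0) (hs : 0 < s) (hl : 0 ≤ lam) (hl1 : lam < 1) :
    Tendsto (fun t : ℝ => (H ((Real.log t : ℂ) + (Real.pi : ℝ) * Complex.I)).im) atTop
      (𝓝 (∫ t in Ioi 0, fI s lam z t)) := by
  set f0 : ℝ → ℝ := fun t : ℝ => (H ((Real.log t : ℂ) + (Real.pi : ℝ) * Complex.I)).im with hf0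
  have hd0 : ∀ t ∈ Ioi (0:ℝ), HasDerivAt f0 (fI s lam z t) t := by
    intro t ht
    have := (hasDerivAt_ray hH Real.pi ht).im'
    unfold fI
    rwa [Complex.div_ofReal_im] at this
  set f : ℝ → ℝ := fun t => if t ≤ 0 then 0 else f0 t with hf
  have hfeq : ∀ t : ℝ, 0 < t → f t = f0 t := fun t ht => by simp [hf, not_le.2 ht]
  have hd : ∀ t ∈ Ioi (0:ℝ), HasDerivAt f (fI s lam z t) t := by
    intro t ht
    refine (hd0 t ht).congr_of_eventuallyEq ?_
    filter_upwards [Ioi_mem_nhds ht] with u hu using hfeq u hu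
  have hi := integrable_fI z hs hl hl1
  have hlim := tendsto_limUnder_of_hasDerivAt_of_integrableOn_Ioi hd hi
  have hf00 : f 0 = 0 := by simp [hf]
  have hc : ContinuousWithinAt f (Ici 0) 0 := by
    rw [← continuousWithinAt_Ioi_iff_Ici]
    unfold ContinuousWithinAt
    rw [hf00]
    have hb : Tendsto (fun t : ℝ => t ^ s * Real.exp (1 * t + |z| * t ^ lam) * (Real.pi - 0))
        (𝓝[>] 0) (𝓝 0) := by
      have h1 : Tendsto (fun t : ℝ => t ^ s * (Real.exp (1 + |z|) * Real.pi)) (𝓝[>] 0) (𝓝 0) := by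
        have : ContinuousAt (fun t : ℝ => t ^ s * (Real.exp (1 + |z|) * Real.pi)) 0 := by
          refine ContinuousAt.mul ?_ continuousAt_const
          exact Real.continuousAt_rpow_const _ _ (Or.inr hs.le)
        have h2 := this.tendsto
        rw [Real.zero_rpow hs.ne', zero_mul] at h2
        exact h2.mono_left nhdsWithin_le_nhds
      refine tendsto_of_tendsto_of_tendsto_of_le_of_le' tendsto_const_nhds h1 ?_ ?_
      · filter_upwards [self_mem_nhdsWithin] with t ht
        have ht : (0:ℝ) < t := ht
        have := Real.pi_pos
        rw [sub_zero]
        positivity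
      · filter_upwards [self_mem_nhdsWithin, nhdsWithin_le_nhds (Iio_mem_nhds (zero_lt_one (α := ℝ)))]
          with t ht ht1
        have ht : (0:ℝ) < t := ht
        have ht1 : t < 1 := ht1
        have := Real.pi_pos
        rw [sub_zero, mul_assoc]
        have h3 : t ^ lam ≤ 1 := Real.rpow_le_one ht.le ht1.le hl
        have h4 : |z| * t ^ lam ≤ |z| := mul_le_of_le_one_right (abs_nonneg z) h3
        have h5 : Real.exp (1 * t + |z| * t ^ lam) ≤ Real.exp (1 + |z|) :=
          Real.exp_le_exp.2 (by linarith)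
        gcongr
    refine squeeze_zero_norm' ?_ hb
    filter_upwards [self_mem_nhdsWithin] with t ht
    have ht : (0:ℝ) < t := ht
    rw [hfeq t ht]
    have h1 := vert_bound hH (Real.log t : ℂ) (a := 0) (b := Real.pi) Real.pi_pos.le
      (fun ψ _ => norm_gW_le s lam z ht ψ 1 (Real.cos_le_one ψ))
    refine le_trans ?_ h1
    have h2 := Complex.abs_im_le_norm (H ((Real.log t : ℂ) + (Real.pi : ℝ) * Complex.I) -
      H ((Real.log t : ℂ) + ((0:ℝ) : ℂ) * Complex.I))
    refine le_trans (le_of_eq ?_) h2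
    simp [hf0, hR]
  have h := integral_Ioi_of_hasDerivAt_of_tendsto hc hd hi hlim
  rw [hf00, sub_zero] at h
  rw [← h] at hlim
  refine hlim.congr' ?_
  filter_upwards [eventually_gt_atTop 0] with t ht using hfeq t ht

lemma lim_gen {s lam z : ℝ} {H : ℂ → ℂ} (hH : ∀ w, HasDerivAt H (gW s lam z w) w)
    (hR : ∀ x : ℝ, (H x).im = 0) (hs : 0 < s) (hl : 0 ≤ lam) (hl1 : lam < 1)
    {ι : Type*} {l : Filter ι} {τ ψ : ι → ℝ} {θ : ℝ} (hθ : Real.pi / 2 < θ)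
    (hτ : Tendsto τ l atTop) (hψ : ∀ᶠ i in l, ψ i ∈ Icc θ Real.pi) :
    Tendsto (fun i => (H ((Real.log (τ i) : ℂ) + (ψ i : ℝ) * Complex.I)).im) l
      (𝓝 (∫ t in Ioi 0, fI s lam z t)) := by
  have h1 := (lim_pi hH hR hs hl hl1).comp hτ
  by_cases hθπ : θ ≤ Real.pi
  swap
  · have : l = ⊥ := by
      rw [← Filter.empty_mem_iff_bot]
      filter_upwards [hψ] with i hi
      exact absurd (hi.1.trans hi.2) hθπ
    rw [this]; exact tendsto_bot
  have hk : 0 < -Real.cos θ := by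
    have := Real.cos_neg_of_pi_div_two_lt_of_lt hθ (by linarith [Real.pi_pos])
    linarith
  have h2 := (((tendsto_dom s |z| hl hl1 hk).comp hτ).mul_const Real.pi)
  rw [zero_mul] at h2
  have h3 : Tendsto (fun i => (H ((Real.log (τ i) : ℂ) + (Real.pi : ℝ) * Complex.I)).im -
      (H ((Real.log (τ i) : ℂ) + (ψ i : ℝ) * Complex.I)).im) l (𝓝 0) := by
    refine squeeze_zero_norm' ?_ h2
    filter_upwards [hψ, hτ.eventually_gt_atTop 0] with i hi ht
    have hb := vert_bound hH (Real.log (τ i) : ℂ) (a := ψ i) (b := Real.pi) hi.2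
      (fun φ hφ => norm_gW_le s lam z ht φ (Real.cos θ) ?_)
    · rw [← Complex.sub_im]
      refine (Complex.abs_im_le_norm _).trans (hb.trans ?_)
      simp only [Function.comp_apply, neg_neg]
      refine mul_le_mul_of_nonneg_left ?_ (by positivity)
      linarith [hi.1, Real.pi_pos]
    · exact Real.cos_le_cos_of_nonneg_of_le_pi (by linarith [Real.pi_pos]) hφ.2 (hi.1.trans hφ.1)
  have h4 := h1.sub h3
  simpa using h4

lemma rpow_le_exp {s δ : ℝ} (hs : 0 < s) (hδ : 0 < δ) :
    ∃ K : ℝ, ∀ Z : ℝ, 0 ≤ Z → Z ^ s ≤ K * Real.exp (δ * Z) := by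
  refine ⟨(s / δ) ^ s, fun Z hZ => ?_⟩
  have h1 : Z ≤ s / δ * Real.exp (δ * Z / s) := by
    have h2 : δ * Z / s ≤ Real.exp (δ * Z / s) := by
      have := Real.add_one_le_exp (δ * Z / s); linarith
    calc Z = s / δ * (δ * Z / s) := by field_simp
      _ ≤ _ := mul_le_mul_of_nonneg_left h2 (by positivity)
  calc Z ^ s ≤ (s / δ * Real.exp (δ * Z / s)) ^ s := Real.rpow_le_rpow hZ h1 hs.le
    _ = _ := by
      rw [Real.mul_rpow (by positivity) (Real.exp_pos _).le, ← Real.exp_mul]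
      congr 2; field_simp

lemma upper_core {s lam z : ℝ} (hs : 0 < s) (hl : 0 < lam) (hl1 : lam < 1) (hz : 0 ≤ z)
    {θ R : ℝ} (hR0 : 0 < R) (hθ : Real.pi / 2 < θ) (hθπ : θ ≤ Real.pi)
    (hθl : lam * θ < Real.pi / 2) :
    |∫ t in Ioi 0, fI s lam z t| ≤
      R ^ s * Real.exp (R - z * (R ^ lam * Real.cos (lam * θ))) * θ +
      Real.exp (-(z * (R ^ lam * Real.cos (lam * θ)))) *
        ∫ t in Ioi 0, t ^ (s - 1) * Real.exp (-(-Real.cos θ) * t + 0 * t ^ lam) := by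
  obtain ⟨H, hH, hR⟩ := exists_prim s lam z
  have hk : 0 < -Real.cos θ := by
    have := Real.cos_neg_of_pi_div_two_lt_of_lt hθ (by linarith [Real.pi_pos])
    linarith
  have hθ0 : 0 < θ := by linarith [Real.pi_pos]
  set c := Real.cos (lam * θ) with hc
  have hc0 : 0 < c := Real.cos_pos_of_mem_Ioo ⟨by nlinarith [Real.pi_pos], hθl⟩
  have hlim := (lim_gen (τ := fun t : ℝ => t) (ψ := fun _ => θ) hH hR hs hl.le hl1 hθ tendsto_id
    (Eventually.of_forall fun _ => ⟨le_rfl, hθπ⟩)).abs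
  refine le_of_tendsto hlim ?_
  filter_upwards [eventually_ge_atTop R] with T hT
  have hint := integrable_dom 0 hs hl.le hl1 hk
  -- the arc
  have h1 : ‖H ((Real.log R : ℂ) + (θ : ℂ) * Complex.I) -
      H ((Real.log R : ℂ) + ((0:ℝ) : ℂ) * Complex.I)‖ ≤
      R ^ s * Real.exp (R - z * (R ^ lam * c)) * (θ - 0) := by
    refine vert_bound hH (Real.log R : ℂ) hθ0.le (fun ψ hψ => ?_)
    rw [norm_gW_logI _ _ _ hR0]
    refine mul_le_mul_of_nonneg_left (Real.exp_le_exp.2 ?_) (by positivity)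
    have h2 : c ≤ Real.cos (lam * ψ) :=
      Real.cos_le_cos_of_nonneg_of_le_pi (mul_nonneg hl.le hψ.1) (by linarith [Real.pi_pos])
        (mul_le_mul_of_nonneg_left hψ.2 hl.le)
    have h3 : z * (R ^ lam * c) ≤ z * (R ^ lam * Real.cos (lam * ψ)) := by gcongr
    have h4 : R * Real.cos ψ ≤ R := mul_le_of_le_one_right hR0.le (Real.cos_le_one ψ)
    linarith
  -- the ray
  have h2 : ‖H ((Real.log T : ℂ) + (θ : ℂ) * Complex.I) -
      H ((Real.log R : ℂ) + (θ : ℂ) * Complex.I)‖ ≤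
      Real.exp (-(z * (R ^ lam * c))) *
        ∫ t in Ioi 0, t ^ (s - 1) * Real.exp (-(-Real.cos θ) * t + 0 * t ^ lam) := by
    have hpos : ∀ t ∈ uIcc R T, 0 < t := fun t ht => by
      rw [uIcc_of_le hT] at ht; exact hR0.trans_le ht.1
    have hcont : ContinuousOn
        (fun t : ℝ => gW s lam z ((Real.log t : ℂ) + θ * Complex.I) / t) (uIcc R T) := by
      intro t ht
      have ht0 : t ≠ 0 := (hpos t ht).ne'
      apply ContinuousAt.continuousWithinAt
      refine ContinuousAt.div ?_ Complex.continuous_ofReal.continuousAt (by exact_mod_cast ht0)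
      refine ContinuousAt.comp (g := gW s lam z)
        (gW_differentiable s lam z).continuous.continuousAt ?_
      exact (Complex.continuous_ofReal.continuousAt.comp (Real.continuousAt_log ht0)).add
        continuousAt_const
    have hftc := intervalIntegral.integral_eq_sub_of_hasDerivAt
      (fun t ht => hasDerivAt_ray hH θ (hpos t ht)) hcont.intervalIntegrable
    rw [← hftc, ← integral_const_mul]
    have hint2 := hint.const_mul (Real.exp (-(z * (R ^ lam * c))))
    have hsub : Ioc R T ⊆ Ioi 0 := fun t ht => hR0.trans ht.1
    refine (intervalIntegral.norm_integral_le_of_norm_le hT (g := fun t => Real.exp (-(z * (R ^ lam * c))) *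
      (t ^ (s - 1) * Real.exp (-(-Real.cos θ) * t + 0 * t ^ lam))) ?_ ?_).trans ?_
    · refine Eventually.of_forall fun t ht => ?_
      have ht0 : 0 < t := hsub ht
      rw [norm_div, norm_gW_logI _ _ _ ht0, Complex.norm_real, Real.norm_of_nonneg ht0.le,
        Real.rpow_sub_one ht0.ne', div_mul_eq_mul_div, mul_div_assoc',
        mul_left_comm (Real.exp _), ← Real.exp_add]
      apply div_le_div_of_nonneg_right _ ht0.le
      refine mul_le_mul_of_nonneg_left (Real.exp_le_exp.2 ?_) (by positivity)
      have h3 : z * (R ^ lam * c) ≤ z * (t ^ lam * c) := by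
        have : R ^ lam ≤ t ^ lam := Real.rpow_le_rpow hR0.le ht.1.le hl.le
        gcongr
      linarith
    · rw [intervalIntegrable_iff_integrableOn_Ioc_of_le hT]
      exact IntegrableOn.mono_set hint2 hsub
    · rw [intervalIntegral.integral_of_le hT]
      refine setIntegral_mono_set hint2 ?_ (LE.le.eventuallyLE hsub)
      refine (ae_restrict_iff' measurableSet_Ioi).2 (Eventually.of_forall fun t ht => ?_)
      have ht0 : (0:ℝ) < t := ht
      simp only [Pi.zero_apply]
      positivity
  have h3 := norm_add_le (H ((Real.log T : ℂ) + (θ : ℂ) * Complex.I) -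
      H ((Real.log R : ℂ) + (θ : ℂ) * Complex.I)) (H ((Real.log R : ℂ) + (θ : ℂ) * Complex.I) -
      H ((Real.log R : ℂ) + ((0:ℝ) : ℂ) * Complex.I))
  rw [sub_add_sub_cancel] at h3
  have h4 := Complex.abs_im_le_norm (H ((Real.log T : ℂ) + (θ : ℂ) * Complex.I) -
      H ((Real.log R : ℂ) + ((0:ℝ) : ℂ) * Complex.I))
  have h5 : (H ((Real.log R : ℂ) + ((0:ℝ) : ℂ) * Complex.I)).im = 0 := by simp [hR]
  rw [Complex.sub_im, h5, sub_zero] at h4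
  rw [sub_zero] at h1
  linarith

/-- superexponential decay -/
lemma upper_bound {s lam : ℝ} (hs : 0 < s) (hl : 0 < lam) (hl1 : lam < 1) :
    ∃ C c : ℝ, 0 < c ∧ 0 ≤ C ∧ ∀ z : ℝ, 0 ≤ z →
      |(∫ t in Ioi 0, fI s lam z t) / Real.pi| ≤ C * Real.exp (-c * z ^ (1 / (1 - lam))) := by
  have hpi := Real.pi_pos
  obtain ⟨θ, hθ, hθ2⟩ : ∃ θ, Real.pi / 2 < θ ∧ θ < min Real.pi (Real.pi / 2 / lam) := by
    apply exists_between
    refine lt_min (by linarith) ?_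
    rw [lt_div_iff₀ hl]
    nlinarith
  have hθπ : θ ≤ Real.pi := (hθ2.trans_le (min_le_left _ _)).le
  have hθl : lam * θ < Real.pi / 2 := by
    have := hθ2.trans_le (min_le_right _ _)
    rw [lt_div_iff₀ hl] at this
    linarith
  have hθ0 : 0 < θ := by linarith
  set c := Real.cos (lam * θ) with hc
  have hc0 : 0 < c := Real.cos_pos_of_mem_Ioo ⟨by nlinarith, hθl⟩
  set J := ∫ t in Ioi (0:ℝ), t ^ (s - 1) * Real.exp (-(-Real.cos θ) * t + 0 * t ^ lam) with hJ
  have hJ0 : 0 ≤ J := by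
    refine setIntegral_nonneg measurableSet_Ioi fun t ht => ?_
    have ht0 : (0:ℝ) < t := ht
    positivity
  have h1l : 0 < 1 - lam := by linarith
  -- choose ε with ε ^ (1 - lam) = c / 2
  set ε := (c / 2) ^ (1 / (1 - lam)) with hε
  have hε0 : 0 < ε := by positivity
  have hεc : ε = ε ^ lam * (c / 2) := by
    have h1 : ε ^ (1 - lam) = c / 2 := by
      rw [hε, ← Real.rpow_mul (by positivity), one_div, inv_mul_cancel₀ h1l.ne', Real.rpow_one]
    rw [← h1, ← Real.rpow_add hε0]; simp
  -- absorb the power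
  obtain ⟨K, hK⟩ := rpow_le_exp (s := s) (δ := ε / 2) hs (by positivity)
  refine ⟨(max 0 (|∫ t in Ioi 0, fI s lam 0 t|) + (|K| * ε ^ s * θ + J)) / Real.pi, ε / 2, by positivity,
    by positivity, fun z hz => ?_⟩
  rw [abs_div, abs_of_pos hpi, div_mul_eq_mul_div]
  apply div_le_div_of_nonneg_right _ hpi.le
  rcases hz.eq_or_lt with rfl | hz
  · rw [Real.zero_rpow (by positivity)]
    simp only [mul_zero, Real.exp_zero, mul_one]
    have := le_max_right 0 (|∫ t in Ioi 0, fI s lam 0 t|)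
    have : 0 ≤ |K| * ε ^ s * θ + J := by positivity
    linarith
  set Z := z ^ (1 / (1 - lam)) with hZ
  have hZ0 : 0 < Z := by positivity
  have hzZ : z * Z ^ lam = Z := by
    have h1 : z = Z ^ (1 - lam) := by
      rw [hZ, ← Real.rpow_mul hz.le, one_div, inv_mul_cancel₀ h1l.ne', Real.rpow_one]
    rw [h1, ← Real.rpow_add hZ0]; simp
  have hu := upper_core hs hl hl1 hz.le (R := ε * Z) (by positivity) hθ hθπ hθl
  rw [← hc, ← hJ] at hu
  have hcomp : z * ((ε * Z) ^ lam * c) = 2 * ε * Z := by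
    rw [Real.mul_rpow hε0.le hZ0.le]
    calc z * (ε ^ lam * Z ^ lam * c) = 2 * (ε ^ lam * (c / 2)) * (z * Z ^ lam) := by ring
      _ = _ := by rw [hzZ, ← hεc]
  rw [hcomp] at hu
  refine hu.trans ?_
  have e1 : (ε * Z) ^ s * Real.exp (ε * Z - 2 * ε * Z) ≤
      |K| * ε ^ s * Real.exp (-(ε / 2) * Z) := by
    have h1 := (hK Z hZ0.le).trans (mul_le_mul_of_nonneg_right (le_abs_self K) (Real.exp_pos _).le)
    rw [Real.mul_rpow hε0.le hZ0.le]
    calc ε ^ s * Z ^ s * Real.exp (ε * Z - 2 * ε * Z)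
        ≤ ε ^ s * (|K| * Real.exp (ε / 2 * Z)) * Real.exp (ε * Z - 2 * ε * Z) := by gcongr
      _ = |K| * ε ^ s * (Real.exp (ε / 2 * Z) * Real.exp (ε * Z - 2 * ε * Z)) := by ring
      _ = _ := by rw [← Real.exp_add]; congr 2; ring
  have e2 : Real.exp (-(2 * ε * Z)) ≤ Real.exp (-(ε / 2) * Z) :=
    Real.exp_le_exp.2 (by nlinarith [mul_pos hε0 hZ0])
  have e3 := mul_le_mul_of_nonneg_right e1 hθ0.le
  have e4 := mul_le_mul_of_nonneg_right e2 hJ0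
  have e5 : 0 ≤ max 0 (|∫ t in Ioi 0, fI s lam 0 t|) * Real.exp (-(ε / 2) * Z) := by positivity
  nlinarith

noncomputable def rC (lam z φ : ℝ) : ℝ :=
  (z * (Real.sin (lam * φ) / Real.sin φ)) ^ (1 / (1 - lam))

lemma sin_lam_pos {lam φ : ℝ} (hl : 0 < lam) (hl1 : lam < 1) (hφ : φ ∈ Ioo 0 Real.pi) :
    0 < Real.sin (lam * φ) :=
  Real.sin_pos_of_pos_of_lt_pi (mul_pos hl hφ.1) (by nlinarith [hφ.1, hφ.2])

lemma rC_base_pos {lam z φ : ℝ} (hl : 0 < lam) (hl1 : lam < 1) (hz : 0 < z)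
    (hφ : φ ∈ Ioo 0 Real.pi) : 0 < z * (Real.sin (lam * φ) / Real.sin φ) :=
  mul_pos hz (div_pos (sin_lam_pos hl hl1 hφ) (Real.sin_pos_of_pos_of_lt_pi hφ.1 hφ.2))

lemma rC_pos {lam z φ : ℝ} (hl : 0 < lam) (hl1 : lam < 1) (hz : 0 < z)
    (hφ : φ ∈ Ioo 0 Real.pi) : 0 < rC lam z φ :=
  Real.rpow_pos_of_pos (rC_base_pos hl hl1 hz hφ) _

lemma rC_phase {lam z φ : ℝ} (hl : 0 < lam) (hl1 : lam < 1) (hz : 0 < z)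
    (hφ : φ ∈ Ioo 0 Real.pi) :
    rC lam z φ * Real.sin φ = z * (rC lam z φ ^ lam * Real.sin (lam * φ)) := by
  have hr := rC_pos hl hl1 hz hφ
  have hb := rC_base_pos hl hl1 hz hφ
  have hs := Real.sin_pos_of_pos_of_lt_pi hφ.1 hφ.2
  have h1l : 1 - lam ≠ 0 := by linarith
  have h1 : rC lam z φ ^ (1 - lam) = z * (Real.sin (lam * φ) / Real.sin φ) := by
    unfold rC
    rw [← Real.rpow_mul hb.le, one_div, inv_mul_cancel₀ h1l, Real.rpow_one]
  have h2 : rC lam z φ = rC lam z φ ^ (1 - lam) * rC lam z φ ^ lam := by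
    rw [← Real.rpow_add hr]; simp
  calc rC lam z φ * Real.sin φ = rC lam z φ ^ (1 - lam) * rC lam z φ ^ lam * Real.sin φ := by
        rw [← h2]
    _ = _ := by rw [h1]; field_simp

lemma rC_log_deriv {lam z φ : ℝ} (hl : 0 < lam) (hl1 : lam < 1) (hz : 0 < z)
    (hφ : φ ∈ Ioo 0 Real.pi) :
    HasDerivAt (fun φ => Real.log (rC lam z φ))
      (1 / (1 - lam) * (lam * Real.cos (lam * φ) / Real.sin (lam * φ) -
        Real.cos φ / Real.sin φ)) φ := by
  have h1 : HasDerivAt (fun φ => 1 / (1 - lam) * (Real.log z + (Real.log (Real.sin (lam * φ)) -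
      Real.log (Real.sin φ))))
      (1 / (1 - lam) * (lam * Real.cos (lam * φ) / Real.sin (lam * φ) -
        Real.cos φ / Real.sin φ)) φ := by
    refine HasDerivAt.const_mul _ (HasDerivAt.const_add _ (HasDerivAt.sub ?_ ?_))
    · have h2 : HasDerivAt (fun φ => lam * φ) lam φ := by
        simpa using (hasDerivAt_id φ).const_mul lam
      have := (h2.sin).log (sin_lam_pos hl hl1 hφ).ne'
      rwa [mul_comm (Real.cos _)] at this
    · exact (Real.hasDerivAt_sin φ).log (Real.sin_pos_of_pos_of_lt_pi hφ.1 hφ.2).ne'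
  refine h1.congr_of_eventuallyEq ?_
  filter_upwards [Ioo_mem_nhds hφ.1 hφ.2] with ψ hψ
  have hs := Real.sin_pos_of_pos_of_lt_pi hψ.1 hψ.2
  have hs' := sin_lam_pos hl hl1 hψ
  unfold rC
  rw [Real.log_rpow (rC_base_pos hl hl1 hz hψ), Real.log_mul hz.ne' (by positivity),
    Real.log_div hs'.ne' hs.ne']

lemma curve_deriv {lam z φ : ℝ} {H : ℂ → ℂ} (hH : ∀ w, HasDerivAt H (gW lam lam z w) w)
    (hl : 0 < lam) (hl1 : lam < 1) (hz : 0 < z) (hφ : φ ∈ Ioo 0 Real.pi) :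
    HasDerivAt (fun φ : ℝ => (H ((Real.log (rC lam z φ) : ℂ) + (φ : ℂ) * Complex.I)).im)
      (rC lam z φ ^ lam * Real.exp (rC lam z φ * Real.cos φ -
        z * (rC lam z φ ^ lam * Real.cos (lam * φ))) *
        (Real.sin ((1 - lam) * φ) / ((1 - lam) * Real.sin φ))) φ := by
  have hr := rC_pos hl hl1 hz hφ
  have h1l : 1 - lam ≠ 0 := by linarith
  have hs := Real.sin_pos_of_pos_of_lt_pi hφ.1 hφ.2
  have hs' := sin_lam_pos hl hl1 hφ
  set a := (1 / (1 - lam) * (lam * Real.cos (lam * φ) / Real.sin (lam * φ) -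
        Real.cos φ / Real.sin φ)) with ha
  have h1 : HasDerivAt (fun φ : ℝ => (Real.log (rC lam z φ) : ℂ) + (φ : ℂ) * Complex.I)
      ((a : ℂ) + Complex.I) φ := by
    refine HasDerivAt.add (rC_log_deriv hl hl1 hz hφ).ofReal_comp ?_
    simpa using (hasDerivAt_id φ).ofReal_comp.mul_const Complex.I
  have h2 := ((hH ((Real.log (rC lam z φ) : ℂ) + (φ : ℂ) * Complex.I)).comp φ h1).im'
  refine h2.congr_deriv ?_
  rw [gW_logI lam lam z hr, rC_phase hl hl1 hz hφ, add_sub_cancel_right, mul_assoc,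
    Complex.im_ofReal_mul, Complex.exp_mul_I, ← Complex.ofReal_cos, ← Complex.ofReal_sin]
  congr 1
  have h3 : ((((Real.cos (lam * φ) : ℝ) : ℂ) + ((Real.sin (lam * φ) : ℝ) : ℂ) * Complex.I) *
      ((a : ℂ) + Complex.I)).im = Real.sin (lam * φ) * a + Real.cos (lam * φ) := by
    simp only [Complex.mul_im, Complex.add_re, Complex.add_im, Complex.ofReal_re, Complex.ofReal_im,
      Complex.mul_re, Complex.I_re, Complex.I_im]
    ring
  rw [h3, ha, sub_mul, one_mul, Real.sin_sub]
  field_simp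
  ring

lemma tendsto_sin_ratio (lam : ℝ) :
    Tendsto (fun φ : ℝ => Real.sin (lam * φ) / Real.sin φ) (𝓝[>] 0) (𝓝 lam) := by
  have h1 : HasDerivAt (fun φ : ℝ => Real.sin (lam * φ)) lam 0 := by
    have h2 : HasDerivAt (fun φ : ℝ => lam * φ) lam 0 := by
      simpa using (hasDerivAt_id (0:ℝ)).const_mul lam
    simpa using h2.sin
  have h2 : HasDerivAt (fun φ : ℝ => Real.sin φ) 1 0 := by
    simpa using Real.hasDerivAt_sin 0
  have h3 := h1.tendsto_slope_zero_right
  have h4 := h2.tendsto_slope_zero_right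
  have h5 := h3.div h4 one_ne_zero
  rw [div_one] at h5
  refine h5.congr' ?_
  filter_upwards [self_mem_nhdsWithin] with φ hφ
  have : φ ≠ 0 := (show (0:ℝ) < φ from hφ).ne'
  simp
  field_simp

lemma tendsto_rC_pi {lam z : ℝ} (hl : 0 < lam) (hl1 : lam < 1) (hz : 0 < z) :
    Tendsto (rC lam z) (𝓝[<] Real.pi) atTop := by
  unfold rC
  refine (tendsto_rpow_atTop (by apply one_div_pos.2; linarith)).comp ?_
  refine Tendsto.const_mul_atTop hz ?_
  simp only [div_eq_mul_inv]
  have h1 : Tendsto (fun φ : ℝ => Real.sin (lam * φ)) (𝓝[<] Real.pi)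
      (𝓝 (Real.sin (lam * Real.pi))) :=
    (Continuous.tendsto (by fun_prop) _).mono_left nhdsWithin_le_nhds
  refine h1.pos_mul_atTop ?_ ?_
  · exact Real.sin_pos_of_pos_of_lt_pi (mul_pos hl Real.pi_pos) (by nlinarith [Real.pi_pos])
  · refine tendsto_inv_nhdsGT_zero.comp ?_
    refine tendsto_nhdsWithin_iff.2 ⟨?_, ?_⟩
    · have := (Real.continuous_sin.tendsto Real.pi).mono_left
        (nhdsWithin_le_nhds (s := Iio Real.pi))
      rwa [Real.sin_pi] at this
    · filter_upwards [self_mem_nhdsWithin, nhdsWithin_le_nhds (Ioi_mem_nhds Real.pi_pos)]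
        with φ h1 h2
      exact Real.sin_pos_of_pos_of_lt_pi h2 h1

lemma lower_bound {lam : ℝ} (hl : 0 < lam) (hl1 : lam < 1) :
    ∃ κ : ℝ, 0 < κ ∧ ∀ z : ℝ, 0 < z →
      κ * (z ^ (1 / (1 - lam))) ^ lam * Real.exp (-z ^ (1 / (1 - lam))) ≤
        (∫ t in Ioi 0, fI lam lam z t) / Real.pi := by
  have hpi := Real.pi_pos
  have h1l : 0 < 1 - lam := by linarith
  have hq : 0 < 1 / (1 - lam) := by positivity
  have hsl : 0 < Real.sin (lam * (Real.pi / 4)) :=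
    Real.sin_pos_of_pos_of_lt_pi (by positivity) (by nlinarith)
  have hsl' : 0 < Real.sin ((1 - lam) * (Real.pi / 4)) :=
    Real.sin_pos_of_pos_of_lt_pi (by positivity) (by nlinarith)
  set ρ := (Real.sin (lam * (Real.pi / 4))) ^ (1 / (1 - lam)) with hρ
  have hρ0 : 0 < ρ := by positivity
  set σ := Real.sin ((1 - lam) * (Real.pi / 4)) / (1 - lam) with hσ
  have hσ0 : 0 < σ := by positivity
  refine ⟨ρ ^ lam * σ / 4, by positivity, fun z hz => ?_⟩
  set Z := z ^ (1 / (1 - lam)) with hZ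
  have hZ0 : 0 < Z := by positivity
  have hzZ : z * Z ^ lam = Z := by
    have h1 : z = Z ^ (1 - lam) := by
      rw [hZ, ← Real.rpow_mul hz.le, one_div, inv_mul_cancel₀ h1l.ne', Real.rpow_one]
    rw [h1, ← Real.rpow_add hZ0]; simp
  obtain ⟨H, hH, hR⟩ := exists_prim lam lam z
  set Φ : ℝ → ℝ := fun φ : ℝ => (H ((Real.log (rC lam z φ) : ℂ) + (φ : ℂ) * Complex.I)).im with hΦ
  have hd := fun φ (hφ : φ ∈ Ioo 0 Real.pi) => curve_deriv hH hl hl1 hz hφ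
  have hpos' : ∀ φ ∈ Ioo 0 Real.pi, 0 < Real.sin ((1 - lam) * φ) / ((1 - lam) * Real.sin φ) :=
    fun φ hφ => div_pos (Real.sin_pos_of_pos_of_lt_pi (mul_pos h1l hφ.1) (by nlinarith [hφ.1, hφ.2]))
      (mul_pos h1l (Real.sin_pos_of_pos_of_lt_pi hφ.1 hφ.2))
  have hmono : MonotoneOn Φ (Ioo 0 Real.pi) := by
    refine monotoneOn_of_deriv_nonneg (convex_Ioo _ _)
      (fun φ hφ => (hd φ hφ).continuousAt.continuousWithinAt) ?_ ?_
    · rw [interior_Ioo]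
      exact fun φ hφ => (hd φ hφ).differentiableAt.differentiableWithinAt
    · rw [interior_Ioo]
      intro φ hφ
      rw [(hd φ hφ).deriv]
      have := hpos' φ hφ
      have := rC_pos hl hl1 hz hφ
      positivity
  -- limit at zero
  have hlim0 : Tendsto Φ (𝓝[>] 0) (𝓝 0) := by
    have h1 : Tendsto (fun φ : ℝ => Real.log (rC lam z φ)) (𝓝[>] 0)
        (𝓝 (Real.log ((z * lam) ^ (1 / (1 - lam))))) := by
      refine Tendsto.log ?_ (by positivity)
      unfold rC
      exact ((tendsto_sin_ratio lam).const_mul z).rpow_const (Or.inr hq.le)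
    have h2 : Tendsto (fun φ : ℝ => (Real.log (rC lam z φ) : ℂ) + (φ : ℂ) * Complex.I) (𝓝[>] 0)
        (𝓝 ((Real.log ((z * lam) ^ (1 / (1 - lam))) : ℂ) + ((0:ℝ) : ℂ) * Complex.I)) := by
      refine Tendsto.add ((Complex.continuous_ofReal.tendsto _).comp h1) (Tendsto.mul_const _ ?_)
      exact (Complex.continuous_ofReal.tendsto _).mono_left nhdsWithin_le_nhds
    have h3 := (Complex.continuous_im.tendsto _).comp (((hH _).continuousAt.tendsto).comp h2)
    have h4 : (H ((Real.log ((z * lam) ^ (1 / (1 - lam))) : ℂ) + ((0:ℝ) : ℂ) * Complex.I)).im = 0 := by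
      rw [Complex.ofReal_zero, zero_mul, add_zero]; exact hR _
    rw [h4] at h3
    exact h3
  have hΦ4 : 0 ≤ Φ (Real.pi / 4) := by
    refine le_of_tendsto hlim0 ?_
    filter_upwards [self_mem_nhdsWithin, nhdsWithin_le_nhds (Iio_mem_nhds
      (show (0:ℝ) < Real.pi / 4 by positivity))] with φ h1 h2
    have h1 : 0 < φ := h1
    have h2 : φ < Real.pi / 4 := h2
    exact hmono ⟨h1, by linarith⟩ ⟨by positivity, by linarith⟩ h2.le
  -- limit at pi
  have hlimpi : Tendsto Φ (𝓝[<] Real.pi) (𝓝 (∫ t in Ioi 0, fI lam lam z t)) := by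
    refine lim_gen (τ := rC lam z) (ψ := fun φ => φ) hH hR hl hl.le hl1
      (θ := 3 * Real.pi / 4) (by linarith) (tendsto_rC_pi hl hl1 hz) ?_
    filter_upwards [self_mem_nhdsWithin, nhdsWithin_le_nhds (Ioi_mem_nhds
      (show 3 * Real.pi / 4 < Real.pi by linarith))] with φ h1 h2
    exact ⟨le_of_lt h2, le_of_lt h1⟩
  have hΦ2 : Φ (Real.pi / 2) ≤ ∫ t in Ioi 0, fI lam lam z t := by
    refine ge_of_tendsto hlimpi ?_
    filter_upwards [self_mem_nhdsWithin, nhdsWithin_le_nhds (Ioi_mem_nhds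
      (show Real.pi / 2 < Real.pi by linarith))] with φ h1 h2
    have h1 : φ < Real.pi := h1
    have h2 : Real.pi / 2 < φ := h2
    exact hmono ⟨by positivity, by linarith⟩ ⟨by linarith, h1⟩ h2.le
  -- the middle piece
  have hmid : (ρ ^ lam * σ * Z ^ lam * Real.exp (-Z)) * (Real.pi / 2 - Real.pi / 4) ≤
      Φ (Real.pi / 2) - Φ (Real.pi / 4) := by
    have hsub : Icc (Real.pi / 4) (Real.pi / 2) ⊆ Ioo 0 Real.pi := fun φ hφ =>
      ⟨by linarith [hφ.1], by linarith [hφ.2]⟩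
    refine Convex.mul_sub_le_image_sub_of_le_deriv (convex_Icc (Real.pi / 4) (Real.pi / 2))
      (fun φ hφ => (hd φ (hsub hφ)).continuousAt.continuousWithinAt)
      (fun φ hφ => (hd φ (hsub (interior_subset hφ))).differentiableAt.differentiableWithinAt) ?_ _
      (left_mem_Icc.2 (by linarith)) _ (right_mem_Icc.2 (by linarith)) (by linarith)
    intro φ hφ
    have hφ : φ ∈ Icc (Real.pi / 4) (Real.pi / 2) := interior_subset hφ
    have hφ' := hsub hφ
    rw [(hd φ hφ').deriv]
    have hs := Real.sin_pos_of_pos_of_lt_pi hφ'.1 hφ'.2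
    have hs' := sin_lam_pos hl hl1 hφ'
    have hs1 := Real.sin_le_one φ
    have hrZ : rC lam z φ = Z * (Real.sin (lam * φ) / Real.sin φ) ^ (1 / (1 - lam)) := by
      unfold rC
      rw [Real.mul_rpow hz.le (by positivity)]
    have hsinle : Real.sin (lam * φ) ≤ Real.sin φ :=
      Real.sin_le_sin_of_le_of_le_pi_div_two (by nlinarith [hφ'.1]) hφ.2 (by nlinarith [hφ'.1])
    have hr1 : rC lam z φ ≤ Z := by
      rw [hrZ]
      refine mul_le_of_le_one_right hZ0.le (Real.rpow_le_one (by positivity) ?_ hq.le)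
      rw [div_le_one hs]; exact hsinle
    have hr2 : Z * ρ ≤ rC lam z φ := by
      rw [hrZ]
      refine mul_le_mul_of_nonneg_left (Real.rpow_le_rpow hsl.le ?_ hq.le) hZ0.le
      rw [le_div_iff₀ hs]
      have h1 : Real.sin (lam * (Real.pi / 4)) ≤ Real.sin (lam * φ) :=
        Real.sin_le_sin_of_le_of_le_pi_div_two (by nlinarith) (by nlinarith [hφ.2, hφ'.1])
          (mul_le_mul_of_nonneg_left hφ.1 hl.le)
      nlinarith
    have hr0 := rC_pos hl hl1 hz hφ'
    have e1 : ρ ^ lam * Z ^ lam ≤ rC lam z φ ^ lam := by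
      rw [← Real.mul_rpow hρ0.le hZ0.le, mul_comm ρ]
      exact Real.rpow_le_rpow (by positivity) hr2 hl.le
    have e2 : Real.exp (-Z) ≤ Real.exp (rC lam z φ * Real.cos φ -
        z * (rC lam z φ ^ lam * Real.cos (lam * φ))) := by
      apply Real.exp_le_exp.2
      have h1 : 0 ≤ Real.cos φ := Real.cos_nonneg_of_mem_Icc ⟨by linarith [hφ'.1], hφ.2⟩
      have h2 : rC lam z φ ^ lam * Real.cos (lam * φ) ≤ Z ^ lam :=
        (mul_le_of_le_one_right (by positivity) (Real.cos_le_one _)).trans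
          (Real.rpow_le_rpow hr0.le hr1 hl.le)
      have h3 := mul_le_mul_of_nonneg_left h2 hz.le
      have h4 : 0 ≤ rC lam z φ * Real.cos φ := mul_nonneg hr0.le h1
      linarith
    have e3 : σ ≤ Real.sin ((1 - lam) * φ) / ((1 - lam) * Real.sin φ) := by
      rw [hσ]
      have h1 : Real.sin ((1 - lam) * (Real.pi / 4)) ≤ Real.sin ((1 - lam) * φ) :=
        Real.sin_le_sin_of_le_of_le_pi_div_two (by nlinarith) (by nlinarith [hφ.2, hφ'.1])
          (mul_le_mul_of_nonneg_left hφ.1 h1l.le)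
      refine div_le_div₀ (hsl'.le.trans h1) h1 (by positivity) ?_
      nlinarith
    calc ρ ^ lam * σ * Z ^ lam * Real.exp (-Z) = (ρ ^ lam * Z ^ lam) * Real.exp (-Z) * σ := by ring
      _ ≤ _ := by gcongr
  rw [le_div_iff₀ hpi]
  calc ρ ^ lam * σ / 4 * Z ^ lam * Real.exp (-Z) * Real.pi
      = (ρ ^ lam * σ * Z ^ lam * Real.exp (-Z)) * (Real.pi / 2 - Real.pi / 4) := by ring
    _ ≤ _ := by linarith

lemma hasSum_mainardi1 {lam : ℝ} (z : ℝ) (hl : 0 < lam) (hl1 : lam < 1) :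
    HasSum (fun n : ℕ => (-z) ^ n / ((n.factorial : ℝ) * Real.Gamma (1 - ((n : ℝ) + 1) * lam)))
      ((∫ t in Ioi 0, fI lam lam z t) / Real.pi) := by
  refine (series_hasSum z hl hl.le hl1).congr_fun fun n => ?_
  rw [show (1:ℝ) - lam - n * lam = 1 - ((n : ℝ) + 1) * lam by ring]

lemma mainardi1_eq {lam : ℝ} (z : ℝ) (hl : 0 < lam) (hl1 : lam < 1) :
    mainardiR lam 1 z = (∫ t in Ioi 0, fI lam lam z t) / Real.pi :=
  (hasSum_mainardi1 z hl hl1).tsum_eq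

lemma Gamma_shift (x : ℝ) : x / Real.Gamma (x + 1) = 1 / Real.Gamma x := by
  by_cases hx : x = 0
  · subst hx; simp [Real.Gamma_zero]
  · rw [Real.Gamma_add_one hx, div_mul_eq_div_div, div_self hx]

lemma mainardi2_eq {lam : ℝ} (z : ℝ) (hl : 1 / 2 < lam) (hl1 : lam < 1) :
    mainardiR lam 2 z = ((∫ t in Ioi 0, fI lam lam z t) / Real.pi -
      lam * z * ((∫ t in Ioi 0, fI (2 * lam - 1) lam z t) / Real.pi)) / (1 - lam) := by
  have hl0 : 0 < lam := by linarith
  have h1 := hasSum_mainardi1 z hl0 hl1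
  have h2 := series_hasSum (s := 2 * lam - 1) z (by linarith) hl0.le hl1
  set a : ℕ → ℝ := fun n =>
    (-z) ^ n / ((n.factorial : ℝ) * Real.Gamma (2 - ((n : ℝ) + 1) * lam)) with ha
  have h3 : HasSum (fun n : ℕ => (n : ℝ) * a n)
      (-z * ((∫ t in Ioi 0, fI (2 * lam - 1) lam z t) / Real.pi)) := by
    rw [← hasSum_nat_add_iff' 1]
    simp only [Finset.range_one, Finset.sum_singleton, Nat.cast_zero, zero_mul, sub_zero]
    refine (h2.mul_left (-z)).congr_fun fun n => ?_
    simp only [ha]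
    rw [show (2:ℝ) - (((n + 1 : ℕ) : ℝ) + 1) * lam = 1 - (2 * lam - 1) - n * lam by
      push_cast; ring, Nat.factorial_succ, pow_succ]
    push_cast
    have hn : (n : ℝ) + 1 ≠ 0 := by positivity
    have hf : (n.factorial : ℝ) ≠ 0 := by positivity
    rw [← mul_div_assoc, ← mul_div_assoc, mul_assoc ((n : ℝ) + 1), mul_div_mul_left _ _ hn]
    ring
  have h4 := (h1.add (h3.mul_left lam)).div_const (1 - lam)
  have h5 : HasSum a (((∫ t in Ioi 0, fI lam lam z t) / Real.pi +
      lam * (-z * ((∫ t in Ioi 0, fI (2 * lam - 1) lam z t) / Real.pi))) / (1 - lam)) := by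
    refine h4.congr_fun fun n => ?_
    have h6 := Gamma_shift (1 - ((n : ℝ) + 1) * lam)
    rw [show 1 - ((n : ℝ) + 1) * lam + 1 = 2 - ((n : ℝ) + 1) * lam by ring] at h6
    have h7 : (1:ℝ) - lam ≠ 0 := by linarith
    rw [eq_div_iff h7]
    simp only [ha]
    have h8 : (-z) ^ n / ((n.factorial : ℝ) * Real.Gamma (1 - ((n : ℝ) + 1) * lam)) =
        (-z) ^ n / (n.factorial : ℝ) *
          ((1 - ((n : ℝ) + 1) * lam) / Real.Gamma (2 - ((n : ℝ) + 1) * lam)) := by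
      rw [h6, div_mul_div_comm, mul_one]
    rw [h8]
    simp only [div_eq_mul_inv, mul_inv]
    ring
  have h9 : mainardiR lam 2 z = _ := h5.tsum_eq
  rw [h9]
  ring

lemma Gamma_half_sub (k : ℕ) :
    1 / (((2 * k).factorial : ℝ) * Real.Gamma (1 / 2 - k)) =
      (-1 / 4) ^ k / (k.factorial : ℝ) / √Real.pi := by
  induction k with
  | zero =>
    have h := Real.Gamma_one_half_eq
    rw [one_div] at h
    simp [h]
  | succ k ih =>
    have h1 := Gamma_shift (1 / 2 - ((k + 1 : ℕ) : ℝ))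
    rw [show (1:ℝ) / 2 - ((k + 1 : ℕ) : ℝ) + 1 = 1 / 2 - k by push_cast; ring] at h1
    rw [one_div, mul_inv, ← one_div (Real.Gamma _), ← h1, show 2 * (k + 1) = 2 * k + 1 + 1 by ring,
      Nat.factorial_succ, Nat.factorial_succ, Nat.factorial_succ k, pow_succ]
    rw [one_div, mul_inv] at ih
    push_cast
    have e1 : (2 * (k : ℝ) + 1) ≠ 0 := by positivity
    have e2 : ((k : ℝ) + 1) ≠ 0 := by positivity
    calc (((2 * (k:ℝ) + 1 + 1) * ((2 * k + 1) * ((2 * k).factorial : ℝ)))⁻¹) *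
          ((1 / 2 - ((k:ℝ) + 1)) / Real.Gamma (1 / 2 - k))
        = ((1 / 2 - ((k:ℝ) + 1)) / ((2 * (k:ℝ) + 1 + 1) * (2 * k + 1))) *
          ((((2 * k).factorial : ℝ))⁻¹ * (Real.Gamma (1 / 2 - k))⁻¹) := by
          simp only [div_eq_mul_inv, mul_inv]; ring
      _ = (-1 / (4 * (k + 1))) * ((-1 / 4) ^ k / (k.factorial : ℝ) / √Real.pi) := by
          rw [ih]; congr 1
          rw [show (2 * (k:ℝ) + 1 + 1) = 2 * (k + 1) by ring]
          field_simp; ring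
      _ = _ := by
          simp only [div_eq_mul_inv, mul_inv]; ring

lemma mainardi_half (z : ℝ) : mainardiR (1 / 2) 1 z = Real.exp (-z ^ 2 / 4) / √Real.pi := by
  have he := (hasSum_exp_real (-z ^ 2 / 4)).div_const (√Real.pi)
  set f : ℕ → ℝ := fun n =>
    (-z) ^ n / ((n.factorial : ℝ) * Real.Gamma (1 - ((n : ℝ) + 1) * (1 / 2))) with hf
  have h1 : HasSum (fun k => f (2 * k)) (Real.exp (-z ^ 2 / 4) / √Real.pi) := by
    refine he.congr_fun fun k => ?_
    simp only [hf]
    rw [show (1:ℝ) - (((2 * k : ℕ) : ℝ) + 1) * (1 / 2) = 1 / 2 - k by push_cast; ring,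
      div_eq_mul_one_div, Gamma_half_sub, pow_mul, neg_sq,
      show -z ^ 2 / 4 = z ^ 2 * (-1 / 4) by ring, mul_pow]
    ring
  have h2 : HasSum (fun k => f (2 * k + 1)) 0 := by
    refine hasSum_zero.congr_fun fun k => ?_
    simp only [hf]
    rw [show (1:ℝ) - (((2 * k + 1 : ℕ) : ℝ) + 1) * (1 / 2) = -(k : ℝ) by push_cast; ring,
      Real.Gamma_neg_nat_eq_zero]
    simp
  have h3 := (h1.even_add_odd h2).tsum_eq
  rw [add_zero] at h3
  exact h3

lemma upper_sq {C c p q a M z : ℝ} {K : ℝ} (hC : 0 ≤ C)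
    (hM : |M| ≤ C * Real.exp (-c * z ^ q)) (hK : a * z ^ p ≤ 2 * c * z ^ q + K) :
    M ^ 2 ≤ C ^ 2 * Real.exp K * Real.exp (-(a * z ^ p)) := by
  have h1 : M ^ 2 ≤ (C * Real.exp (-c * z ^ q)) ^ 2 := by
    rw [← sq_abs]; exact pow_le_pow_left₀ (abs_nonneg _) hM 2
  refine h1.trans ?_
  rw [mul_pow, ← Real.exp_nat_mul, mul_assoc, ← Real.exp_add]
  refine mul_le_mul_of_nonneg_left (Real.exp_le_exp.2 ?_) (by positivity)
  push_cast; linarith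

lemma mainardi1_upper {lam : ℝ} (hl : 0 < lam) (hl1 : lam < 1 / 2) :
    ∃ B : ℝ, ∀ z : ℝ, 0 ≤ z → mainardiR lam 1 z ^ 2 ≤ B * Real.exp (-z) := by
  obtain ⟨C, c, hc, hC, h⟩ := upper_bound hl hl (by linarith : lam < 1)
  have h1l : 0 < 1 - lam := by linarith
  obtain ⟨K, hK⟩ := pow_absorb (p := 1) (q := 1 / (1 - lam)) (ε := 2 * c) 1 zero_le_one
    (by rw [lt_div_iff₀ h1l]; linarith) (by positivity)
  refine ⟨C ^ 2 * Real.exp K, fun z hz => ?_⟩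
  have h1 := upper_sq hC (h z hz) (hK z hz)
  rw [mainardi1_eq z hl (by linarith)]
  simpa using h1

lemma mainardi2_upper {lam : ℝ} (hl : 1 / 2 < lam) (hl1 : lam < 1) :
    ∃ B : ℝ, ∀ z : ℝ, 0 ≤ z → mainardiR lam 2 z ^ 2 ≤ B * Real.exp (-z ^ 2 / 4) := by
  have hl0 : 0 < lam := by linarith
  have h1l : 0 < 1 - lam := by linarith
  obtain ⟨C1, c1, hc1, hC1, h1⟩ := upper_bound hl0 hl0 hl1
  obtain ⟨C2, c2, hc2, hC2, h2⟩ := upper_bound (s := 2 * lam - 1) (by linarith) hl0 hl1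
  set c := min c1 (c2 / 2) with hcdef
  have hc : 0 < c := lt_min hc1 (by positivity)
  obtain ⟨L, hL⟩ := rpow_le_exp (s := 1 - lam) (δ := c2 / 2) h1l (by positivity)
  obtain ⟨K, hK⟩ := pow_absorb (p := 2) (q := 1 / (1 - lam)) (ε := 2 * c) (1 / 4) zero_le_two
    (by rw [lt_div_iff₀ h1l]; linarith) (by positivity)
  set C := (C1 + lam * (|L| * C2)) / (1 - lam) with hCdef
  have hC : 0 ≤ C := by positivity
  refine ⟨C ^ 2 * Real.exp K, fun z hz => ?_⟩
  have h3 : |mainardiR lam 2 z| ≤ C * Real.exp (-c * z ^ (1 / (1 - lam))) := by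
    rw [mainardi2_eq z hl hl1]
    set I1 := (∫ t in Ioi 0, fI lam lam z t) / Real.pi
    set I2 := (∫ t in Ioi 0, fI (2 * lam - 1) lam z t) / Real.pi
    have g1 := h1 z hz
    have g2 := h2 z hz
    set Z := z ^ (1 / (1 - lam)) with hZ
    have hZ0 : 0 ≤ Z := by positivity
    have hzZ : z = Z ^ (1 - lam) := by
      rw [hZ, ← Real.rpow_mul hz, one_div, inv_mul_cancel₀ h1l.ne', Real.rpow_one]
    have g3 : z ≤ |L| * Real.exp (c2 / 2 * Z) := by
      have := hL Z hZ0
      rw [← hzZ] at this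
      exact this.trans (mul_le_mul_of_nonneg_right (le_abs_self L) (Real.exp_pos _).le)
    have g4 : z * |I2| ≤ |L| * C2 * Real.exp (-c * Z) := by
      calc z * |I2| ≤ (|L| * Real.exp (c2 / 2 * Z)) * (C2 * Real.exp (-c2 * Z)) := by gcongr
        _ = |L| * C2 * (Real.exp (c2 / 2 * Z) * Real.exp (-c2 * Z)) := by ring
        _ = |L| * C2 * Real.exp (-(c2 / 2) * Z) := by rw [← Real.exp_add]; congr 2; ring
        _ ≤ _ := by
          have : c ≤ c2 / 2 := min_le_right _ _
          gcongr
    have g5 : |I1| ≤ C1 * Real.exp (-c * Z) := by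
      have : c ≤ c1 := min_le_left _ _
      refine g1.trans ?_
      gcongr
    rw [abs_div, abs_of_pos h1l, hCdef, div_mul_eq_mul_div]
    apply div_le_div_of_nonneg_right _ h1l.le
    have g6 := abs_sub I1 (lam * z * I2)
    rw [abs_mul, abs_mul, abs_of_pos hl0, abs_of_nonneg hz] at g6
    have g7 := mul_le_mul_of_nonneg_left g4 hl0.le
    nlinarith
  have h4 := upper_sq hC h3 (hK z hz)
  rw [Real.rpow_two] at h4
  convert h4 using 3
  ring

lemma mainardi1_lower {lam : ℝ} (hl : 0 < lam) (hl1 : lam < 1 / 2) :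
    ∃ m : ℝ, 0 < m ∧ ∀ z : ℝ, 0 ≤ z → m * Real.exp (-z ^ 2 / 8) ≤ mainardiR lam 1 z := by
  have h1l : 0 < 1 - lam := by linarith
  have hl1' : lam < 1 := by linarith
  obtain ⟨κ, hκ, h⟩ := lower_bound hl hl1'
  obtain ⟨K, hK⟩ := pow_absorb (p := 1 / (1 - lam)) (q := 2) (ε := 1 / 8) 1 (by positivity)
    (by rw [div_lt_iff₀ h1l]; linarith) (by positivity)
  have hpos : ∀ z : ℝ, 0 ≤ z → 0 < mainardiR lam 1 z := by
    intro z hz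
    rcases hz.eq_or_lt with rfl | hz
    · unfold mainardiR
      rw [tsum_eq_single 0 (fun n hn => by simp [hn])]
      have := Real.Gamma_pos_of_pos h1l
      simp [this]
    · rw [mainardi1_eq z hl hl1']
      exact lt_of_lt_of_le (by positivity) (h z hz)
  have hcont : ContinuousOn (mainardiR lam 1) (Icc 0 1) := by
    unfold mainardiR
    refine continuousOn_tsum (fun n => by fun_prop)
      (hasSum_mainardi1 1 hl hl1').summable.norm (fun n z hz => ?_)
    rw [norm_div, norm_div]
    refine div_le_div_of_nonneg_right ?_ (norm_nonneg _)
    rw [norm_pow, norm_pow, norm_neg, norm_neg, norm_one, one_pow]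
    exact pow_le_one₀ (norm_nonneg _) (by rw [Real.norm_of_nonneg hz.1]; exact hz.2)
  obtain ⟨z0, hz0, hmin⟩ := isCompact_Icc.exists_isMinOn (nonempty_Icc.2 zero_le_one) hcont
  have hm0 := hpos z0 hz0.1
  refine ⟨min (mainardiR lam 1 z0) (κ * Real.exp (-K)), lt_min hm0 (by positivity), fun z hz => ?_⟩
  rcases le_total z 1 with hz1 | hz1
  · have h2 : mainardiR lam 1 z0 ≤ mainardiR lam 1 z := hmin ⟨hz, hz1⟩
    refine le_trans ?_ h2
    calc min (mainardiR lam 1 z0) (κ * Real.exp (-K)) * Real.exp (-z ^ 2 / 8)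
        ≤ mainardiR lam 1 z0 * 1 := by
          refine mul_le_mul (min_le_left _ _) ?_ (Real.exp_pos _).le hm0.le
          rw [Real.exp_le_one_iff]
          have := sq_nonneg z
          linarith
      _ = _ := mul_one _
  · have hz0 : 0 < z := by linarith
    rw [mainardi1_eq z hl hl1']
    refine le_trans ?_ (h z hz0)
    have hZ1 : 1 ≤ (z ^ (1 / (1 - lam))) ^ lam :=
      Real.one_le_rpow (Real.one_le_rpow hz1 (by positivity)) hl.le
    have h3 := hK z hz
    rw [Real.rpow_two] at h3
    calc min (mainardiR lam 1 z0) (κ * Real.exp (-K)) * Real.exp (-z ^ 2 / 8)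
        ≤ κ * Real.exp (-K) * Real.exp (-z ^ 2 / 8) := by
          gcongr; exact min_le_right _ _
      _ = κ * 1 * Real.exp (-K + -z ^ 2 / 8) := by rw [Real.exp_add]; ring
      _ ≤ κ * (z ^ (1 / (1 - lam))) ^ lam * Real.exp (-z ^ (1 / (1 - lam))) := by
          refine mul_le_mul (mul_le_mul_of_nonneg_left hZ1 hκ.le) (Real.exp_le_exp.2 (by linarith))
            (Real.exp_pos _).le (by positivity)

lemma greenG_one (β x : ℝ) : greenG β 1 x = mainardiR (β / 2) (⌈β⌉₊ : ℝ) |x| / 2 := by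
  unfold greenG
  simp only [Real.one_rpow, div_one]
  ring

lemma ceil_one {β : ℝ} (h0 : 0 < β) (h1 : β ≤ 1) : (⌈β⌉₊ : ℝ) = 1 := by
  have : ⌈β⌉₊ = 1 := by
    rw [Nat.ceil_eq_iff one_ne_zero]; simp [h0, h1]
  rw [this]; simp

lemma ceil_two {β : ℝ} (h0 : 1 < β) (h1 : β ≤ 2) : (⌈β⌉₊ : ℝ) = 2 := by
  have : ⌈β⌉₊ = 2 := by
    rw [Nat.ceil_eq_iff two_ne_zero]; simp [h0, h1]
  rw [this]; simp

/-- for `β ∈ (0,2)`, `Ψ_β = sup_x G_β(1,x)²/𝒢_β(1,x)` is finite, and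
for `β ∈ (0,1)`, `Ψ̲_β = inf_x G_β(1,x)²/𝒢̲_β(1,x) > 0`, where
`𝒢̲_β(1,x) = (4π)^{−1/2} exp(−x²/4)`. -/
theorem Psi_finite_and_Psi_lower_pos (β : ℝ) (hβ0 : 0 < β) (hβ2 : β < 2) :
    BddAbove (Set.range fun x : ℝ => greenG β 1 x ^ 2 / refKernel β 1 x) ∧
    (β < 1 →
      0 < ⨅ x : ℝ, greenG β 1 x ^ 2
        / ((4 * Real.pi) ^ (-(1 : ℝ) / 2) * Real.exp (-x ^ 2 / 4))) := by
  have hK : (0:ℝ) < (4 * Real.pi) ^ (-(1 : ℝ) / 2) := by positivity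
  constructor
  · rcases lt_or_ge β 1 with h1 | h1
    · obtain ⟨B, hB⟩ := mainardi1_upper (lam := β / 2) (by linarith) (by linarith)
      refine ⟨B / 2, ?_⟩
      rintro _ ⟨x, rfl⟩
      have h2 := hB |x| (abs_nonneg x)
      simp only [refKernel, if_pos h1, Real.one_rpow, mul_one, div_one]
      rw [greenG_one, ceil_one hβ0 h1.le, div_le_iff₀ (by positivity)]
      nlinarith
    · have key : ∃ B : ℝ, ∀ z : ℝ, 0 ≤ z →
          mainardiR (β / 2) (⌈β⌉₊ : ℝ) z ^ 2 ≤ B * Real.exp (-z ^ 2 / 4) := by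
        rcases h1.eq_or_lt with h1 | h1
        · subst h1
          rw [ceil_one one_pos le_rfl]
          refine ⟨1 / Real.pi, fun z hz => ?_⟩
          rw [mainardi_half, div_pow, Real.sq_sqrt Real.pi_pos.le, one_div_mul_eq_div]
          refine div_le_div_of_nonneg_right ?_ Real.pi_pos.le
          have h2 : Real.exp (-z ^ 2 / 4) ≤ 1 := by
            rw [Real.exp_le_one_iff]
            have := sq_nonneg z
            linarith
          have h3 := Real.exp_pos (-z ^ 2 / 4)
          nlinarith
        · rw [ceil_two h1 hβ2.le]
          exact mainardi2_upper (by linarith) (by linarith)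
      obtain ⟨B, hB⟩ := key
      refine ⟨B / 4 / (4 * Real.pi) ^ (-(1 : ℝ) / 2), ?_⟩
      rintro _ ⟨x, rfl⟩
      have h2 := hB |x| (abs_nonneg x)
      rw [sq_abs] at h2
      simp only [refKernel, if_neg (not_lt.2 h1), Real.one_rpow, mul_one]
      rw [greenG_one, div_le_iff₀ (by positivity), ← mul_assoc, div_mul_cancel₀ _ hK.ne']
      linarith
  · intro h1
    obtain ⟨m, hm, h⟩ := mainardi1_lower (lam := β / 2) (by linarith) (by linarith)
    refine lt_of_lt_of_le (b := m ^ 2 / 4 / (4 * Real.pi) ^ (-(1 : ℝ) / 2)) (by positivity) ?_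
    refine le_ciInf fun x => ?_
    have h2 := h |x| (abs_nonneg x)
    rw [sq_abs] at h2
    have h3 := pow_le_pow_left₀ (by positivity) h2 2
    rw [mul_pow, ← Real.exp_nat_mul,
      show ((2:ℕ) : ℝ) * (-x ^ 2 / 8) = -x ^ 2 / 4 by push_cast; ring] at h3
    rw [greenG_one, ceil_one hβ0 h1.le, le_div_iff₀ (by positivity), ← mul_assoc,
      div_mul_cancel₀ _ hK.ne']
    linarith
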